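/- The set 𝒞(L) of frame congruences of a frame L, ordered by inclusion, is a frame, with infima given by set-theoretic intersection. -/

import Mathlib

/-- A frame congruence on a frame `L`: an equivalence relation respecting finite meets and
arbitrary (set-indexed) joins. -/
def IsFrameCong {L : Type} [Order.Frame L] (r : L → L → Prop) : Prop :=
  Equivalence r ∧
    (∀ a b c d : L, r a b → r c d → r (a ⊓ c) (b ⊓ d)) ∧
    (∀ (ι : Type) (a b : ι → L), (∀ i, r (a i) (b i)) → r (⨆ i, a i) (⨆ i, b i))

namespace IsFrameCong

variable {L : Type} [Order.Frame L] {r : L → L → Prop}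

theorem sup (hr : IsFrameCong r) {a b c d : L} (hab : r a b) (hcd : r c d) :
    r (a ⊔ c) (b ⊔ d) := by
  have h := hr.2.2 Bool (fun i => cond i a c) (fun i => cond i b d)
    (by rintro (_ | _) <;> assumption)
  simpa only [iSup_bool_eq, cond_true, cond_false] using h

/-- The largest element of the class of `a`. -/
def classTop (r : L → L → Prop) (a : L) : L := ⨆ x : {b // r a b}, x.1

theorem le_classTop {a b : L} (h : r a b) : b ≤ classTop r a :=
  le_iSup (fun x : {b // r a b} => x.1) ⟨b, h⟩

theorem rel_classTop (hr : IsFrameCong r) (a : L) : r a (classTop r a) := by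
  have : Nonempty {b // r a b} := ⟨⟨a, hr.1.refl a⟩⟩
  simpa only [iSup_const, classTop] using
    hr.2.2 {b // r a b} (fun _ => a) (fun x => x.1) fun x => x.2

theorem classTop_mono (hr : IsFrameCong r) : Monotone (classTop r) := by
  intro a b hab
  have h := hr.sup (hr.rel_classTop a) (hr.1.refl b)
  rw [sup_eq_right.2 hab] at h
  exact le_sup_left.trans (le_classTop h)

/-- The nucleus sending each element to the largest element of its class. -/
def toNucleus (hr : IsFrameCong r) : Nucleus L where
  toFun := classTop r
  map_inf' a b := le_antisymm
    (le_inf (hr.classTop_mono inf_le_left) (hr.classTop_mono inf_le_right))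
    (le_classTop (hr.2.1 _ _ _ _ (hr.rel_classTop a) (hr.rel_classTop b)))
  idempotent' a :=
    le_classTop (hr.1.trans (hr.rel_classTop a) (hr.rel_classTop (classTop r a)))
  le_apply' a := le_classTop (hr.1.refl a)

theorem toNucleus_apply (hr : IsFrameCong r) (a : L) : hr.toNucleus a = classTop r a := rfl

theorem ker (n : Nucleus L) : IsFrameCong fun a b => n a = n b := by
  refine ⟨⟨fun _ => rfl, Eq.symm, Eq.trans⟩, fun a b c d hab hcd => ?_, fun ι a b h => ?_⟩
  · exact (map_inf n a c).trans ((congrArg₂ _ hab hcd).trans (map_inf n b d).symm)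
  · have key : ∀ a b : ι → L, (∀ i, n (a i) = n (b i)) → n (⨆ i, a i) ≤ n (⨆ i, b i) := by
      intro a b h
      rw [← n.idempotent (⨆ i, b i)]
      refine n.monotone (iSup_le fun i => ?_)
      exact n.le_apply.trans ((h i).le.trans (n.monotone (le_iSup b i)))
    exact (key a b h).antisymm (key b a fun i => (h i).symm)

theorem toNucleus_ker (n : Nucleus L) : (ker n).toNucleus = n := by
  ext a
  rw [toNucleus_apply]
  refine le_antisymm (iSup_le fun x => ?_) (le_classTop (n.idempotent a).symm)
  exact n.le_apply.trans x.2.ge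

theorem toNucleus_le_iff {s : L → L → Prop} (hr : IsFrameCong r) (hs : IsFrameCong s) :
    hr.toNucleus ≤ hs.toNucleus ↔ ∀ a b, r a b → s a b := by
  constructor
  · intro h a b hab
    have le : ∀ a b, r a b → classTop s b ≤ classTop s a := fun a b hab =>
      (hs.classTop_mono ((le_classTop hab).trans (h a))).trans (hs.toNucleus.idempotent a).le
    have e := (le b a (hr.1.symm hab)).antisymm (le a b hab)
    exact hs.1.trans (e ▸ hs.rel_classTop a) (hs.1.symm (hs.rel_classTop b))
  · exact fun h a => le_classTop (h _ _ (hr.rel_classTop a))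

/-- Frame congruences correspond to nuclei. -/
noncomputable def orderIsoNucleus : {r : L → L → Prop // IsFrameCong r} ≃o Nucleus L :=
  RelIso.ofSurjective
    (OrderEmbedding.ofMapLEIff (fun r => r.2.toNucleus) fun r s => toNucleus_le_iff r.2 s.2)
    fun n => ⟨⟨_, ker n⟩, toNucleus_ker n⟩

theorem sInter (S : Set {r : L → L → Prop // IsFrameCong r}) :
    IsFrameCong fun a b => ∀ r ∈ S, r.1 a b :=
  ⟨⟨fun a r _ => r.2.1.refl a, fun h r hr => r.2.1.symm (h r hr),
      fun h h' r hr => r.2.1.trans (h r hr) (h' r hr)⟩,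
    fun _ _ _ _ h h' r hr => r.2.2.1 _ _ _ _ (h r hr) (h' r hr),
    fun ι a b h r hr => r.2.2.2 ι a b fun i => h i r hr⟩

/-- The complete lattice of frame congruences, with intersections as infima. -/
abbrev completeLattice : CompleteLattice {r : L → L → Prop // IsFrameCong r} :=
  letI : InfSet {r : L → L → Prop // IsFrameCong r} := ⟨fun S => ⟨_, sInter S⟩⟩
  completeLatticeOfInf _ fun _ =>
    ⟨fun r hr _ _ h => h r hr, fun _ hs a b h _ hr => hs hr a b h⟩

/-- The frame of frame congruences, with intersections as infima. -/
abbrev frame : Order.Frame {r : L → L → Prop // IsFrameCong r} :=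
  letI := completeLattice (L := L)
  .ofMinimalAxioms
    { inf_sSup_le_iSup_inf := fun r S => by
        rw [← orderIsoNucleus.le_iff_le]
        simp only [map_inf, OrderIso.map_sSup, OrderIso.map_iSup, inf_iSup_eq, le_refl] }

end IsFrameCong

/-- The set `𝒞(L)` of frame congruences of a frame `L`, ordered by inclusion, is a frame,
with infima given by set-theoretic intersection. -/
theorem congruences_frame (L : Type) [Order.Frame L] :
    ∃ inst : Order.Frame {r : L → L → Prop // IsFrameCong r},
      (∀ r s : {r : L → L → Prop // IsFrameCong r},
        (letI := inst; r ≤ s) ↔ ∀ a b : L, r.1 a b → s.1 a b) ∧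
      (∀ S : Set {r : L → L → Prop // IsFrameCong r},
        letI := inst
        ∀ a b : L, (sInf S).1 a b ↔ ∀ r ∈ S, r.1 a b) :=
  ⟨IsFrameCong.frame, fun _ _ => Iff.rfl, fun _ _ _ => Iff.rfl⟩
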